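/- Let Ψ be an m×G complex matrix whose columns ψ_1,…,ψ_G are all nonzero, and define its mutual coherence ν(Ψ) = max over pairs t ≠ v of |⟨ψ_t, ψ_v⟩| / (‖ψ_t‖₂ ‖ψ_v‖₂). Let Q be a positive integer with ν(Ψ) < 1/(2Q − 1). Then every Q-sparse vector is the unique sparsest preimage of its image: if α, β ∈ ℂ^G satisfy Ψα = Ψβ, ‖α‖₀ ≤ Q and ‖β‖₀ ≤ Q, then α = β. -/

import Mathlib

/-- The `g`-th column of a complex matrix, viewed as a vector in `EuclideanSpace`. -/
noncomputable def colVec {m G : ℕ} (Ψ : Matrix (Fin m) (Fin G) ℂ) (g : Fin G) :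
    EuclideanSpace ℂ (Fin m) :=
  (EuclideanSpace.equiv (Fin m) ℂ).symm (fun i => Ψ i g)

/-- The mutual coherence of a matrix: the maximum over pairs of distinct columns of
`|⟨ψ_t, ψ_v⟩| / (‖ψ_t‖₂ ‖ψ_v‖₂)`. -/
noncomputable def coherence {m G : ℕ} (Ψ : Matrix (Fin m) (Fin G) ℂ) : ℝ :=
  sSup {x : ℝ | ∃ t v : Fin G, t ≠ v ∧
    x = ‖inner (𝕜 := ℂ) (colVec Ψ t) (colVec Ψ v)‖ / (‖colVec Ψ t‖ * ‖colVec Ψ v‖)}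

/-- The number of nonzero entries (ℓ₀ "norm") of a vector. -/
noncomputable def l0norm {G : ℕ} (α : Fin G → ℂ) : ℕ :=
  (Finset.univ.filter fun g => α g ≠ 0).card

/-- A vanishing linear combination of `s.card` nonzero vectors with pairwise coherence at most `μ`
is trivial as soon as `(s.card - 1) * μ < 1`. -/
theorem eq_zero_of_sum_smul_eq_zero_of_coherence {𝕜 E ι : Type*} [RCLike 𝕜]
    [NormedAddCommGroup E] [InnerProductSpace 𝕜 E] (v : ι → E) (c : ι → 𝕜)
    (s : Finset ι) (μ : ℝ) (hv : ∀ i ∈ s, v i ≠ 0)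
    (hμ : ∀ i ∈ s, ∀ j ∈ s, i ≠ j → ‖inner 𝕜 (v i) (v j)‖ ≤ μ * (‖v i‖ * ‖v j‖))
    (hs : ((s.card : ℝ) - 1) * μ < 1) (hsum : ∑ i ∈ s, c i • v i = 0) :
    ∀ i ∈ s, c i = 0 := by
  classical
  set w : ι → ℝ := fun i => ‖c i‖ * ‖v i‖ with hw
  have hw0 : ∀ i, 0 ≤ w i := fun i => by positivity
  have key : ∀ t ∈ s, w t ≤ μ * (∑ i ∈ s, w i - w t) := by
    intro t ht
    have hpos : 0 < ‖v t‖ := norm_pos_iff.mpr (hv t ht)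
    have h0 : ∑ i ∈ s, c i * inner 𝕜 (v t) (v i) = 0 := by
      simpa [inner_sum, inner_smul_right] using congrArg (inner 𝕜 (v t)) hsum
    rw [← Finset.add_sum_erase s _ ht] at h0
    have h1 : ‖c t * inner 𝕜 (v t) (v t)‖ = w t * ‖v t‖ := by
      rw [norm_mul, inner_self_eq_norm_sq_to_K, norm_pow, RCLike.norm_ofReal, abs_norm, hw]
      ring
    have h2 : w t * ‖v t‖ ≤ (μ * ∑ i ∈ s.erase t, w i) * ‖v t‖ := by
      rw [← h1, eq_neg_of_add_eq_zero_left h0, norm_neg, Finset.mul_sum, Finset.sum_mul]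
      refine norm_sum_le_of_le _ fun i hi => ?_
      obtain ⟨hit, his⟩ := Finset.mem_erase.mp hi
      rw [norm_mul]
      calc ‖c i‖ * ‖inner 𝕜 (v t) (v i)‖ ≤ ‖c i‖ * (μ * (‖v t‖ * ‖v i‖)) :=
            mul_le_mul_of_nonneg_left (hμ t ht i his hit.symm) (norm_nonneg _)
        _ = μ * w i * ‖v t‖ := by rw [hw]; ring
    rw [← Finset.add_sum_erase s w ht, add_sub_cancel_left]
    exact le_of_mul_le_mul_right h2 hpos
  have hle : ∑ i ∈ s, w i ≤ ((s.card : ℝ) - 1) * μ * ∑ i ∈ s, w i := by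
    calc ∑ t ∈ s, w t ≤ ∑ t ∈ s, μ * (∑ i ∈ s, w i - w t) := Finset.sum_le_sum key
      _ = ((s.card : ℝ) - 1) * μ * ∑ i ∈ s, w i := by
        rw [← Finset.mul_sum, Finset.sum_sub_distrib, Finset.sum_const, nsmul_eq_mul]
        ring
  have hW : ∑ i ∈ s, w i = 0 :=
    le_antisymm (by nlinarith) (Finset.sum_nonneg fun i _ => hw0 i)
  intro i hi
  have hwi := (Finset.sum_eq_zero_iff_of_nonneg fun i _ => hw0 i).mp hW i hi
  exact norm_eq_zero.mp ((mul_eq_zero.mp hwi).resolve_right (norm_ne_zero_iff.mpr (hv i hi)))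

theorem coherence_nonneg {m G : ℕ} (Ψ : Matrix (Fin m) (Fin G) ℂ) : 0 ≤ coherence Ψ := by
  refine Real.sSup_nonneg ?_
  rintro x ⟨t, v, -, rfl⟩
  positivity

theorem norm_inner_colVec_le_coherence {m G : ℕ} (Ψ : Matrix (Fin m) (Fin G) ℂ)
    {t v : Fin G} (htv : t ≠ v) (ht : colVec Ψ t ≠ 0) (hv : colVec Ψ v ≠ 0) :
    ‖inner ℂ (colVec Ψ t) (colVec Ψ v)‖ ≤ coherence Ψ * (‖colVec Ψ t‖ * ‖colVec Ψ v‖) := by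
  have hpos : 0 < ‖colVec Ψ t‖ * ‖colVec Ψ v‖ :=
    mul_pos (norm_pos_iff.mpr ht) (norm_pos_iff.mpr hv)
  rw [← div_le_iff₀ hpos]
  refine le_csSup ⟨1, ?_⟩ ⟨t, v, htv, rfl⟩
  rintro x ⟨i, j, -, rfl⟩
  exact div_le_one_of_le₀ (norm_inner_le_norm _ _) (by positivity)

theorem sum_smul_colVec {m G : ℕ} (Ψ : Matrix (Fin m) (Fin G) ℂ) (c : Fin G → ℂ) :
    ∑ g, c g • colVec Ψ g = WithLp.toLp 2 (Ψ.mulVec c) := by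
  ext i
  simp [colVec, Matrix.mulVec, dotProduct, mul_comm]


/-- If all columns of `Ψ` are nonzero and its mutual coherence satisfies
`ν(Ψ) < 1/(2Q−1)`, then every `Q`-sparse vector is the unique sparsest preimage of its image. -/
theorem sparse_uniqueness_of_coherence {m G : ℕ} (Q : ℕ) (hQ : 0 < Q)
    (Ψ : Matrix (Fin m) (Fin G) ℂ)
    (hnz : ∀ g : Fin G, colVec Ψ g ≠ 0)
    (hcoh : coherence Ψ < 1 / (2 * (Q : ℝ) - 1))
    (α β : Fin G → ℂ)
    (hα : l0norm α ≤ Q) (hβ : l0norm β ≤ Q)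
    (heq : Ψ.mulVec α = Ψ.mulVec β) :
    α = β := by
  classical
  set s : Finset (Fin G) :=
    (Finset.univ.filter fun g => α g ≠ 0) ∪ (Finset.univ.filter fun g => β g ≠ 0) with hs
  have hcard : s.card ≤ 2 * Q := by
    have h := Finset.card_union_le
      (Finset.univ.filter fun g => α g ≠ 0) (Finset.univ.filter fun g => β g ≠ 0)
    unfold l0norm at hα hβ
    rw [hs]
    omega
  have hout : ∀ g, g ∉ s → α g - β g = 0 := by
    intro g hg
    simp only [hs, Finset.mem_union, Finset.mem_filter_univ, not_or, not_not] at hg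
    rw [hg.1, hg.2, sub_zero]
  have hsmall : ((s.card : ℝ) - 1) * coherence Ψ < 1 := by
    have hQ' : (1 : ℝ) ≤ Q := by exact_mod_cast hQ
    have hcard' : (s.card : ℝ) ≤ 2 * Q := by exact_mod_cast hcard
    rw [lt_div_iff₀ (by linarith)] at hcoh
    nlinarith [coherence_nonneg Ψ]
  have hsum : ∑ g ∈ s, (α - β) g • colVec Ψ g = 0 := by
    rw [Finset.sum_subset (Finset.subset_univ s) fun g _ hg => by
      rw [Pi.sub_apply, hout g hg, zero_smul], sum_smul_colVec, Matrix.mulVec_sub, heq, sub_self,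
      WithLp.toLp_zero]
  have hzero := eq_zero_of_sum_smul_eq_zero_of_coherence (colVec Ψ) (α - β) s (coherence Ψ)
    (fun g _ => hnz g)
    (fun t _ v _ htv => norm_inner_colVec_le_coherence Ψ htv (hnz t) (hnz v)) hsmall hsum
  funext g
  by_cases hg : g ∈ s
  · exact sub_eq_zero.mp (hzero g hg)
  · exact sub_eq_zero.mp (hout g hg)
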